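/- (Local unstable manifold) Assume in addition that 0 ∈ D, F(0) = 0, 2√(νλ) < τ and μ > (τ + 2λ)/(τ − 2λν), and set θ₀ = 2λ/τ, θ₁ = τ/ν − 2λ/τ, θ₂ = (μ−1)/(μν+1) and θ₃ = τ/(2ν). Then F has a local unstable manifold at 0: there exist a closed ball U ⊂ X centered at 0 and a θ₀-Lipschitz map γ* : U → Y with γ*(0) = 0 such that F(graph γ*) ∩ (U × Y) = graph γ*. Moreover it is unique in the following sense: if W is the graph of a θ-Lipschitz map γ : U → Y with 0 ∈ W, θ < min{θ₁, θ₂, θ₃}, and F(W) ⊇ W, then W = graph γ*. -/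

import Mathlib

open Set

/-- lower bound for the horizontal displacement -/
lemma lum_lower {X Y : Type*} [NormedAddCommGroup X] [NormedAddCommGroup Y]
    (d u Au : X) (v : Y) (m P N t : ℝ) (hN : 0 ≤ N) (ht : 0 ≤ t) (hm : 0 < m) (hP : P ≤ 1)
    (hA : m * ‖u‖ ≤ ‖Au‖)
    (h : ‖d - Au‖ ≤ (1 - P) * m * ‖u‖ + N * m * ‖v‖) (hv : ‖v‖ ≤ t * ‖u‖) :
    (P - N * t) * ‖Au‖ ≤ ‖d‖ := by
  have h1 : ‖Au‖ ≤ ‖d‖ + ‖d - Au‖ := by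
    have := norm_sub_le d (d - Au)
    simpa using this
  have h2 : (1 - P) * m * ‖u‖ ≤ (1 - P) * ‖Au‖ := by
    rw [mul_assoc]; exact mul_le_mul_of_nonneg_left hA (by linarith)
  have h3 : N * m * ‖v‖ ≤ N * t * ‖Au‖ := by
    calc N * m * ‖v‖ ≤ N * m * (t * ‖u‖) := by gcongr
      _ = N * t * (m * ‖u‖) := by ring
      _ ≤ _ := by gcongr
  nlinarith

/-- contraction estimate, real-number version -/
lemma lum_contr_real (P N L T a w δ s t0 t3 e X : ℝ)
    (hP1 : P ≤ 1) (hN : 0 ≤ N) (hL : 0 ≤ L) (hT : 0 ≤ T) (ht0 : 0 ≤ t0) (ht3 : t0 ≤ t3)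
    (hE3 : 0 < P - N * t3) (hδ : 0 ≤ δ)
    (h1 : a ≤ (1 - P) * a + N * w)
    (h2 : w ≤ δ * s + t0 * a)
    (h3 : (P - N * t3) * s ≤ X)
    (he : e ≤ L * a + T * w) :
    e ≤ (L * N + T * P) / ((P - N * t0) * (P - N * t3)) * δ * X := by
  have hNt : N * t0 ≤ N * t3 := by gcongr
  have hE0 : 0 < P - N * t0 := by linarith
  have hNt0 : 0 ≤ N * t0 := by positivity
  have hP : 0 < P := by linarith
  have h1' : P * a ≤ N * w := by linarith
  have hw : (P - N * t0) * w ≤ P * δ * s := by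
    nlinarith [mul_le_mul_of_nonneg_left h2 hP.le, mul_le_mul_of_nonneg_left h1' ht0]
  have hK : 0 ≤ L * N + T * P := by positivity
  have he2 : P * e ≤ (L * N + T * P) * w := by
    nlinarith [mul_le_mul_of_nonneg_left he hP.le, mul_le_mul_of_nonneg_left h1' hL]
  have h5 : (P - N * t0) * (P - N * t3) * w ≤ P * δ * X := by
    have := mul_le_mul_of_nonneg_left hw hE3.le
    have h6 := mul_le_mul_of_nonneg_left h3 (mul_nonneg hP.le hδ)
    nlinarith
  have hQ : 0 < (P - N * t0) * (P - N * t3) := by positivity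
  rw [div_mul_eq_mul_div, div_mul_eq_mul_div, le_div_iff₀ hQ]
  have h7 := mul_le_mul_of_nonneg_left h5 hK
  have h8 := mul_le_mul_of_nonneg_left he2 hQ.le
  have : P * (e * ((P - N * t0) * (P - N * t3))) ≤ P * ((L * N + T * P) * δ * X) := by
    nlinarith
  exact le_of_mul_le_mul_left this hP

theorem lum_core {X Y : Type*} [NormedAddCommGroup X] [NormedSpace ℝ X] [CompleteSpace X]
    [NormedAddCommGroup Y] [CompleteSpace Y]
    (ξ : X × Y → X) (η : X × Y → Y) (A : X ≃L[ℝ] X)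
    (m P N L T t0 t3 ρ : ℝ) (hm : 0 < m) (hρ : 0 < ρ)
    (hP1 : P ≤ 1) (hN : 0 ≤ N) (hL : 0 ≤ L) (hT : 0 ≤ T) (ht0 : 0 ≤ t0) (ht3 : t0 ≤ t3)
    (hE1 : L + T * t0 ≤ t0 * (P - N * t0))
    (hE2 : L * N + T * P < (P - N * t0) * (P - N * t3))
    (hE3 : 0 < P - N * t3)
    (hE4 : 1 ≤ m * (P - N * t0))
    (hA : ∀ u, m * ‖u‖ ≤ ‖A u‖)
    (hξ0 : ξ 0 = 0) (hη0 : η 0 = 0)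
    (hξ : ∀ x1 x2 : X, ∀ y1 y2 : Y, ‖x1‖ ≤ ρ → ‖x2‖ ≤ ρ → ‖y1‖ ≤ t3 * ρ → ‖y2‖ ≤ t3 * ρ →
      ‖ξ (x1, y1) - ξ (x2, y2) - A (x1 - x2)‖ ≤
        (1 - P) * m * ‖x1 - x2‖ + N * m * ‖y1 - y2‖)
    (hη : ∀ x1 x2 : X, ∀ y1 y2 : Y, ‖x1‖ ≤ ρ → ‖x2‖ ≤ ρ → ‖y1‖ ≤ t3 * ρ → ‖y2‖ ≤ t3 * ρ →
      ‖η (x1, y1) - η (x2, y2)‖ ≤ L * ‖A (x1 - x2)‖ + T * (m * ‖y1 - y2‖)) :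
    ∃ γ : X → Y, γ 0 = 0 ∧
      (∀ x y, ‖x‖ ≤ ρ → ‖y‖ ≤ ρ → ‖γ x - γ y‖ ≤ t0 * ‖x - y‖) ∧
      (∀ x, ‖x‖ ≤ ρ → ∃ u, ‖u‖ ≤ ρ ∧ ξ (u, γ u) = x ∧ η (u, γ u) = γ x) ∧
      (∀ u, ‖u‖ ≤ ρ → ‖ξ (u, γ u)‖ ≤ ρ → η (u, γ u) = γ (ξ (u, γ u))) ∧
      (∀ g : X → Y, (∀ x, ‖x‖ ≤ ρ → ‖g x‖ ≤ t3 * ‖x‖) →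
        (∀ x, ‖x‖ ≤ ρ → ∃ u, ‖u‖ ≤ ρ ∧ ξ (u, g u) = x ∧ η (u, g u) = g x) →
        ∀ x, ‖x‖ ≤ ρ → g x = γ x) := by
  have hNt : N * t0 ≤ N * t3 := by gcongr
  have hE0 : 0 < P - N * t0 := by linarith
  have hP : 0 < P := by nlinarith [mul_nonneg hN ht0]
  have ht3' : 0 ≤ t3 := ht0.trans ht3
  set q := (L * N + T * P) / ((P - N * t0) * (P - N * t3)) with hq
  have hq0 : 0 ≤ q := by positivity
  have hq1 : q < 1 := by rw [hq, div_lt_one (by positivity)]; exact hE2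
  have hbig : ∀ g : X → Y, (∀ x, ‖x‖ ≤ ρ → ‖g x‖ ≤ t3 * ‖x‖) → ∀ x, ‖x‖ ≤ ρ →
      ‖g x‖ ≤ t3 * ρ := fun g hg x hx => (hg x hx).trans (by gcongr)
  let G : (X → Y) → Prop := fun g => g 0 = 0 ∧
    ∀ x y, ‖x‖ ≤ ρ → ‖y‖ ≤ ρ → ‖g x - g y‖ ≤ t0 * ‖x - y‖
  have hG3 : ∀ g, G g → ∀ x, ‖x‖ ≤ ρ → ‖g x‖ ≤ t3 * ‖x‖ := by
    intro g hg x hx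
    have := hg.2 x 0 hx (by simpa using hρ.le)
    rw [hg.1, sub_zero, sub_zero] at this
    exact this.trans (by gcongr)
  -- contraction
  have contr : ∀ g1 g2 : X → Y, ∀ δ : ℝ, 0 ≤ δ → (∀ x, ‖x‖ ≤ ρ → ‖g1 x‖ ≤ t3 * ‖x‖) → G g2 →
      (∀ x, ‖x‖ ≤ ρ → ‖g1 x - g2 x‖ ≤ δ * ‖x‖) → ∀ u1 u2, ‖u1‖ ≤ ρ → ‖u2‖ ≤ ρ →
      ξ (u1, g1 u1) = ξ (u2, g2 u2) →
      ‖η (u1, g1 u1) - η (u2, g2 u2)‖ ≤ q * δ * ‖ξ (u1, g1 u1)‖ := by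
    intro g1 g2 δ hδ hg1 hg2 hd u1 u2 hu1 hu2 heq
    have hb1 := hbig g1 hg1 u1 hu1
    have hb2 := hbig g2 (hG3 g2 hg2) u2 hu2
    have e1 := hξ u1 u2 _ _ hu1 hu2 hb1 hb2
    have e2 := hη u1 u2 _ _ hu1 hu2 hb1 hb2
    rw [heq, sub_self, zero_sub, norm_neg] at e1
    have hAu := hA (u1 - u2)
    refine lum_contr_real P N L T ‖A (u1 - u2)‖ (m * ‖g1 u1 - g2 u2‖) δ (m * ‖u1‖) t0 t3 _ _
      hP1 hN hL hT ht0 ht3 hE3 hδ ?_ ?_ ?_ e2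
    · have : (1 - P) * (m * ‖u1 - u2‖) ≤ (1 - P) * ‖A (u1 - u2)‖ :=
        mul_le_mul_of_nonneg_left hAu (by linarith)
      linarith
    · have h5 : ‖g1 u1 - g2 u2‖ ≤ δ * ‖u1‖ + t0 * ‖u1 - u2‖ := by
        have h6 : g1 u1 - g2 u2 = (g1 u1 - g2 u1) + (g2 u1 - g2 u2) := by abel
        rw [h6]
        exact (norm_add_le _ _).trans (add_le_add (hd u1 hu1) (hg2.2 u1 u2 hu1 hu2))
      have h7 := mul_le_mul_of_nonneg_left h5 hm.le
      have h8 := mul_le_mul_of_nonneg_left hAu ht0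
      linarith
    · have e3 := hξ u1 0 (g1 u1) 0 hu1 (by simpa using hρ.le) hb1 (by simpa using by positivity)
      have h00 : ((0 : X), (0 : Y)) = 0 := rfl
      rw [h00, hξ0] at e3
      simp only [sub_zero] at e3
      have := lum_lower _ _ _ _ m P N t3 hN ht3' hm hP1 (hA u1) e3 (hg1 u1 hu1)
      exact (mul_le_mul_of_nonneg_left (hA u1) hE3.le).trans this
  -- Lipschitz
  have lip : ∀ g, G g → ∀ u1 u2, ‖u1‖ ≤ ρ → ‖u2‖ ≤ ρ →
      ‖η (u1, g u1) - η (u2, g u2)‖ ≤ t0 * ‖ξ (u1, g u1) - ξ (u2, g u2)‖ := by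
    intro g hg u1 u2 hu1 hu2
    have hb1 := hbig g (hG3 g hg) u1 hu1
    have hb2 := hbig g (hG3 g hg) u2 hu2
    have hgl := hg.2 u1 u2 hu1 hu2
    have e1 := lum_lower _ _ _ _ m P N t0 hN ht0 hm hP1 (hA _)
      (hξ u1 u2 _ _ hu1 hu2 hb1 hb2) hgl
    have e2 := hη u1 u2 _ _ hu1 hu2 hb1 hb2
    have h3 : m * ‖g u1 - g u2‖ ≤ t0 * ‖A (u1 - u2)‖ := by
      calc m * ‖g u1 - g u2‖ ≤ m * (t0 * ‖u1 - u2‖) := by gcongr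
        _ = t0 * (m * ‖u1 - u2‖) := by ring
        _ ≤ _ := mul_le_mul_of_nonneg_left (hA _) ht0
    have h4 := mul_le_mul_of_nonneg_left h3 hT
    have h5 := mul_le_mul_of_nonneg_right hE1 (norm_nonneg (A (u1 - u2)))
    have h6 := mul_le_mul_of_nonneg_left e1 ht0
    linarith
  -- surjectivity
  have surj : ∀ g, G g → ∀ x, ‖x‖ ≤ ρ → ∃ u, ‖u‖ ≤ ρ ∧ ξ (u, g u) = x := by
    intro g hg x hx
    let R : (A : X →L[ℝ] X).NonlinearRightInverse :=
      { toFun := A.symm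
        nnnorm := ⟨m⁻¹, by positivity⟩
        bound' := fun y => by
          have := hA (A.symm y)
          rw [A.apply_symm_apply] at this
          change _ ≤ m⁻¹ * ‖y‖
          rw [inv_mul_eq_div, le_div_iff₀ hm]; linarith
        right_inv' := fun y => by simp }
    have hc0 : 0 ≤ ((1 - P) + N * t0) * m := by
      have : 0 ≤ 1 - P := by linarith
      positivity
    have happ : ApproximatesLinearOn (fun u => ξ (u, g u)) (A : X →L[ℝ] X)
        (Metric.closedBall 0 ρ) ⟨((1 - P) + N * t0) * m, hc0⟩ := by
      intro u1 hu1 u2 hu2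
      rw [mem_closedBall_zero_iff] at hu1 hu2
      have := hξ u1 u2 _ _ hu1 hu2 (hbig g (hG3 g hg) u1 hu1) (hbig g (hG3 g hg) u2 hu2)
      refine this.trans ?_
      have h9 : N * m * ‖g u1 - g u2‖ ≤ N * m * (t0 * ‖u1 - u2‖) := by
        gcongr; exact hg.2 u1 u2 hu1 hu2
      change _ ≤ ((1 - P) + N * t0) * m * ‖u1 - u2‖
      linarith
    have hs := happ.surjOn_closedBall_of_nonlinearRightInverse R hρ.le (b := 0) subset_rfl
    have hx' : x ∈ Metric.closedBall (ξ (0, g 0)) (((R.nnnorm : ℝ)⁻¹ -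
        ((⟨((1 - P) + N * t0) * m, hc0⟩ : NNReal) : ℝ)) * ρ) := by
      have h00 : ((0 : X), g 0) = 0 := by rw [hg.1]; rfl
      rw [h00, hξ0, mem_closedBall_zero_iff]
      change ‖x‖ ≤ ((m⁻¹)⁻¹ - ((1 - P) + N * t0) * m) * ρ
      rw [inv_inv]
      nlinarith
    obtain ⟨u, hu, hux⟩ := hs hx'
    exact ⟨u, by simpa using hu, hux⟩
  -- graph transform
  have step : ∀ g : {g // G g}, ∃ g' : {g // G g}, ∀ x, ‖x‖ ≤ ρ →
      ∃ u, ‖u‖ ≤ ρ ∧ ξ (u, g.1 u) = x ∧ η (u, g.1 u) = g'.1 x := by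
    rintro ⟨g, hg⟩
    have h := surj g hg
    choose! f hf1 hf2 using h
    have hl : ∀ x y, ‖x‖ ≤ ρ → ‖y‖ ≤ ρ →
        ‖η (f x, g (f x)) - η (f y, g (f y))‖ ≤ t0 * ‖x - y‖ := by
      intro x y hx hy
      have := lip g hg (f x) (f y) (hf1 x hx) (hf1 y hy)
      rwa [hf2 x hx, hf2 y hy] at this
    refine ⟨⟨fun x => η (f x, g (f x)), ?_, hl⟩, fun x hx => ⟨f x, hf1 x hx, hf2 x hx, rfl⟩⟩
    have hz : ‖(0 : X)‖ ≤ ρ := by simpa using hρ.le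
    have := lip g hg (f 0) 0 (hf1 0 hz) hz
    have h00 : ((0 : X), g 0) = 0 := by rw [hg.1]; rfl
    rw [hf2 0 hz, h00, hξ0, hη0, sub_zero, sub_zero, norm_zero, mul_zero] at this
    exact norm_le_zero_iff.1 this
  choose Γ hΓ using step
  let g0 : {g // G g} := ⟨fun _ => 0, rfl, fun x y _ _ => by
    simpa using by positivity⟩
  let s : ℕ → {g // G g} := fun k => Γ^[k] g0
  have hs : ∀ k, s (k + 1) = Γ (s k) := fun k => Function.iterate_succ_apply' _ _ _
  have hdiff : ∀ k, ∀ x, ‖x‖ ≤ ρ → ‖(s k).1 x - (s (k + 1)).1 x‖ ≤ t3 * q ^ k * ‖x‖ := by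
    intro k
    induction k with
    | zero =>
      intro x hx
      have h0 : (s 0).1 x = 0 := rfl
      rw [h0, zero_sub, norm_neg, pow_zero, mul_one]
      exact hG3 _ (s (0 + 1)).2 x hx
    | succ k ih =>
      intro x hx
      obtain ⟨u1, hu1, h11, h12⟩ := hΓ (s k) x hx
      obtain ⟨u2, hu2, h21, h22⟩ := hΓ (s (k + 1)) x hx
      rw [hs (k + 1), hs k, ← hs k, ← h22, hs k, ← h12, ← hs k]
      have := contr (s k).1 (s (k + 1)).1 (t3 * q ^ k) (by positivity) (hG3 _ (s k).2)
        (s (k + 1)).2 ih u1 u2 hu1 hu2 (h11.trans h21.symm)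
      rw [h11] at this
      refine this.trans (le_of_eq ?_)
      ring
  have hlim : ∀ x, ‖x‖ ≤ ρ → ∃ y, Filter.Tendsto (fun k => (s k).1 x) Filter.atTop (nhds y) := by
    intro x hx
    apply cauchySeq_tendsto_of_complete
    refine cauchySeq_of_le_geometric q (t3 * ‖x‖) hq1 fun k => ?_
    rw [dist_eq_norm]
    exact (hdiff k x hx).trans (le_of_eq (by ring))
  choose! γ hγ using hlim
  have hγG : G γ := by
    have hz : ‖(0 : X)‖ ≤ ρ := by simpa using hρ.le
    refine ⟨?_, fun x y hx hy => ?_⟩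
    · have h1 := hγ 0 hz
      have h2 : (fun k => (s k).1 0) = fun _ => 0 := funext fun k => (s k).2.1
      rw [h2] at h1
      exact tendsto_nhds_unique h1 tendsto_const_nhds
    · exact le_of_tendsto ((hγ x hx).sub (hγ y hy)).norm
        (Filter.Eventually.of_forall fun k => (s k).2.2 x y hx hy)
  have hdist : ∀ k x, ‖x‖ ≤ ρ → ‖(s k).1 x - γ x‖ ≤ t3 / (1 - q) * q ^ k * ‖x‖ := by
    intro k x hx
    have := dist_le_of_le_geometric_of_tendsto q (t3 * ‖x‖) hq1 (fun k => by
      rw [dist_eq_norm]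
      exact (hdiff k x hx).trans (le_of_eq (by ring))) (hγ x hx) k
    rw [dist_eq_norm] at this
    exact this.trans (le_of_eq (by ring))
  have hC : 0 ≤ t3 / (1 - q) := div_nonneg ht3' (by linarith)
  have hpow : ∀ C : ℝ, Filter.Tendsto (fun k : ℕ => C * q ^ k) Filter.atTop (nhds 0) := by
    intro C
    simpa using (tendsto_pow_atTop_nhds_zero_of_lt_one hq0 hq1).const_mul C
  have hfixed : ∀ u, ‖u‖ ≤ ρ → ‖ξ (u, γ u)‖ ≤ ρ → η (u, γ u) = γ (ξ (u, γ u)) := by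
    intro u hu hx
    set x := ξ (u, γ u) with hxd
    have key : ∀ k, ‖(s (k + 1)).1 x - η (u, γ u)‖ ≤ (q * (t3 / (1 - q)) * ‖x‖) * q ^ k := by
      intro k
      obtain ⟨u1, hu1, h11, h12⟩ := hΓ (s k) x hx
      rw [hs k, ← h12]
      have := contr (s k).1 γ (t3 / (1 - q) * q ^ k) (by positivity) (hG3 _ (s k).2)
        hγG (hdist k) u1 u hu1 hu (h11.trans hxd)
      rw [h11] at this
      exact this.trans (le_of_eq (by ring))
    have l1 : Filter.Tendsto (fun k => (s (k + 1)).1 x) Filter.atTop (nhds (η (u, γ u))) := by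
      rw [tendsto_iff_norm_sub_tendsto_zero]
      exact squeeze_zero (fun _ => norm_nonneg _) key (hpow _)
    exact tendsto_nhds_unique l1 ((Filter.tendsto_add_atTop_iff_nat 1).2 (hγ x hx))
  have hinv : ∀ x, ‖x‖ ≤ ρ → ∃ u, ‖u‖ ≤ ρ ∧ ξ (u, γ u) = x ∧ η (u, γ u) = γ x := by
    intro x hx
    obtain ⟨u, hu, hux⟩ := surj γ hγG x hx
    refine ⟨u, hu, hux, ?_⟩
    have := hfixed u hu (by rw [hux]; exact hx)
    rwa [hux] at this
  refine ⟨γ, hγG.1, hγG.2, hinv, hfixed, ?_⟩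
  intro g hg hW x hx
  have key : ∀ k : ℕ, ∀ x, ‖x‖ ≤ ρ → ‖g x - γ x‖ ≤ (2 * t3 * q ^ k) * ‖x‖ := by
    intro k
    induction k with
    | zero =>
      intro x hx
      have a1 := hg x hx
      have a2 := hG3 γ hγG x hx
      have := norm_sub_le (g x) (γ x)
      rw [pow_zero]; linarith
    | succ k ih =>
      intro x hx
      obtain ⟨u1, hu1, h11, h12⟩ := hW x hx
      obtain ⟨u2, hu2, h21, h22⟩ := hinv x hx
      rw [← h12, ← h22]
      have := contr g γ (2 * t3 * q ^ k) (by positivity) hg hγG ih u1 u2 hu1 hu2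
        (h11.trans h21.symm)
      rw [h11] at this
      exact this.trans (le_of_eq (by ring))
  have h0 : ‖g x - γ x‖ ≤ 0 := by
    refine ge_of_tendsto (hpow (2 * t3 * ‖x‖)) (Filter.Eventually.of_forall fun k => ?_)
    exact (key k x hx).trans (le_of_eq (by ring))
  exact sub_eq_zero.1 (norm_le_zero_iff.1 h0)

lemma lum_mvt {E F : Type*} [NormedAddCommGroup E] [NormedSpace ℝ E] [NormedAddCommGroup F]
    [NormedSpace ℝ F] (f : E → F) (f' : E → E →L[ℝ] F) (s : Set E) (hs : Convex ℝ s)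
    (hf : ∀ z ∈ s, HasFDerivAt f (f' z) z) (a b : E) (ha : a ∈ s) (hb : b ∈ s) (C : ℝ)
    (hC : ∀ z ∈ s, ‖f' z (a - b)‖ ≤ C) : ‖f a - f b‖ ≤ C := by
  have hmem : ∀ t ∈ Icc (0 : ℝ) 1, b + t • (a - b) ∈ s := fun t ht =>
    hs.add_smul_sub_mem hb ha ht
  have h := norm_image_sub_le_of_norm_deriv_le_segment_01' (f := fun t : ℝ => f (b + t • (a - b)))
    (f' := fun t => f' (b + t • (a - b)) (a - b)) (C := C) ?_ ?_
  · simpa using h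
  · intro t ht
    have h1 : HasDerivAt (fun t : ℝ => b + t • (a - b)) (a - b) t := by
      simpa using ((hasDerivAt_id t).smul_const (a - b)).const_add b
    exact ((hf _ (hmem t ht)).comp_hasDerivAt t h1).hasDerivWithinAt
  · intro t ht
    exact hC _ (hmem t ⟨ht.1, ht.2.le⟩)

lemma lum_eps (μ ν lam τ : ℝ) (hμ : 0 < μ) (hν : 0 < ν) (hlam : 0 ≤ lam)
    (hτ0 : 0 < τ) (hτ1 : τ ≤ 1) (hcone : 2 * Real.sqrt (ν * lam) < τ)
    (hμbig : (τ + 2 * lam) / (τ - 2 * lam * ν) < μ) :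
    2 * lam / τ < τ / (2 * ν) ∧ ∃ ε > 0, ε < 1 ∧
      lam * (1 + ε) + (1 - τ + ε) * (2 * lam / τ) ≤
        (2 * lam / τ) * ((1 - ε) - (ν + ε) * (2 * lam / τ)) ∧
      lam * (1 + ε) * (ν + ε) + (1 - τ + ε) * (1 - ε) <
        ((1 - ε) - (ν + ε) * (2 * lam / τ)) * ((1 - ε) - (ν + ε) * (τ / (2 * ν))) ∧
      0 < (1 - ε) - (ν + ε) * (τ / (2 * ν)) ∧
      1 ≤ μ * ((1 - ε) - (ν + ε) * (2 * lam / τ)) := by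
  have hs : 4 * (ν * lam) < τ ^ 2 := by
    have h := Real.sq_sqrt (mul_nonneg hν.le hlam)
    have h0 := Real.sqrt_nonneg (ν * lam)
    nlinarith
  have hlt : 2 * lam / τ < τ / (2 * ν) := by
    rw [div_lt_div_iff₀ hτ0 (by positivity)]; nlinarith
  refine ⟨hlt, ?_⟩
  set t0 := 2 * lam / τ with ht0
  set t3 := τ / (2 * ν) with ht3
  have e0 : τ * t0 = 2 * lam := by rw [ht0]; field_simp
  have e3 : ν * t3 = τ / 2 := by rw [ht3]; field_simp
  have ht0' : 0 ≤ t0 := by positivity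
  have hnt : ν * t0 < τ / 2 := by rw [← e3]; gcongr
  have hden : 0 < τ - 2 * lam * ν := by nlinarith
  have hμ' : 1 + t0 < μ * (1 - ν * t0) := by
    rw [div_lt_iff₀ hden] at hμbig
    have : τ * (1 + t0) < τ * (μ * (1 - ν * t0)) := by
      have r : τ * (μ * (1 - ν * t0)) = μ * (τ - ν * (τ * t0)) := by ring
      rw [r, mul_add, e0]; linarith
    exact lt_of_mul_lt_mul_left this hτ0.le
  have c1 : ∀ᶠ ε in nhds (0 : ℝ), (1 + ε) * τ + 2 * (1 - τ + ε) < 2 * ((1 - ε) - (ν + ε) * t0) := by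
    apply ContinuousAt.eventually_lt (by fun_prop) (by fun_prop)
    simp only [add_zero, sub_zero]; linarith
  have c2 : ∀ᶠ ε in nhds (0 : ℝ), lam * (1 + ε) * (ν + ε) + (1 - τ + ε) * (1 - ε) <
        ((1 - ε) - (ν + ε) * t0) * ((1 - ε) - (ν + ε) * t3) := by
    apply ContinuousAt.eventually_lt (by fun_prop) (by fun_prop)
    simp only [add_zero, sub_zero, mul_one]
    rw [e3]
    nlinarith
  have c3 : ∀ᶠ ε in nhds (0 : ℝ), 0 < (1 - ε) - (ν + ε) * t3 := by
    apply ContinuousAt.eventually_lt (by fun_prop) (by fun_prop)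
    simp only [add_zero, sub_zero]; linarith
  have c4 : ∀ᶠ ε in nhds (0 : ℝ), 1 < μ * ((1 - ε) - (ν + ε) * t0) := by
    apply ContinuousAt.eventually_lt (by fun_prop) (by fun_prop)
    simp only [add_zero, sub_zero]; linarith
  have c5 : ∀ᶠ ε in nhds (0 : ℝ), ε < 1 := eventually_lt_nhds one_pos
  have call := (c1.and (c2.and (c3.and (c4.and c5))))
  obtain ⟨ε, ⟨d1, d2, d3, d4, d5⟩, hε⟩ :=
    ((call.filter_mono nhdsWithin_le_nhds).and (self_mem_nhdsWithin (s := Ioi (0 : ℝ)))).exists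
  refine ⟨ε, hε, d5, ?_, d2, d3, d4.le⟩
  have h := mul_le_mul_of_nonneg_left d1.le ht0'
  have : lam = τ * t0 / 2 := by linarith
  rw [this]
  linarith

/-- **Local unstable manifold.** Under the cone-field hypotheses, with `0 ∈ D` a
fixed point of `F = (ξ,η)`, `2√(νλ) < τ` and `μ > (τ+2λ)/(τ-2λν)`: there is a
closed ball `U = B̄(0,ρ) ⊂ X` and a `θ₀`-Lipschitz map `γ* : U → Y`, `γ*(0) = 0`,
whose graph is `F`-invariant: `F(graph γ*) ∩ (U × Y) = graph γ*`; and it is unique: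
any graph `W ∋ 0` of a `θ`-Lipschitz map on `U` with `θ < min{θ₁,θ₂,θ₃}` and
`F(W) ⊇ W` equals `graph γ*`. Here `θ₀ = 2λ/τ`, `θ₁ = τ/ν - 2λ/τ`,
`θ₂ = (μ-1)/(μν+1)`, `θ₃ = τ/(2ν)`. -/
theorem local_unstable_manifold
    (n : ℕ) (Y : Type*) [NormedAddCommGroup Y] [NormedSpace ℝ Y] [CompleteSpace Y]
    (D : Set (EuclideanSpace ℝ (Fin n) × Y)) (hD : IsOpen D)
    (ξ : EuclideanSpace ℝ (Fin n) × Y → EuclideanSpace ℝ (Fin n))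
    (η : EuclideanSpace ℝ (Fin n) × Y → Y)
    (ξ' : EuclideanSpace ℝ (Fin n) × Y →
      (EuclideanSpace ℝ (Fin n) × Y →L[ℝ] EuclideanSpace ℝ (Fin n)))
    (η' : EuclideanSpace ℝ (Fin n) × Y → (EuclideanSpace ℝ (Fin n) × Y →L[ℝ] Y))
    (hξ : ∀ z ∈ D, HasFDerivAt ξ (ξ' z) z)
    (hη : ∀ z ∈ D, HasFDerivAt η (η' z) z)
    (hξc : ContinuousOn ξ' D) (hηc : ContinuousOn η' D)
    (μ ν lam τ : ℝ) (hμ : 0 < μ) (hν : 0 < ν) (hlam : 0 ≤ lam)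
    (hτ0 : 0 < τ) (hτ1 : τ ≤ 1)
    (h1 : ∀ z ∈ D, ∀ u : EuclideanSpace ℝ (Fin n), μ * ‖u‖ ≤ ‖ξ' z (u, 0)‖)
    (h2 : ∀ z ∈ D, ∀ (u : EuclideanSpace ℝ (Fin n)) (v : Y),
      ‖ξ' z (0, v)‖ * ‖u‖ ≤ ν * ‖ξ' z (u, 0)‖ * ‖v‖)
    (h3 : ∀ z ∈ D, ∀ u : EuclideanSpace ℝ (Fin n),
      ‖η' z (u, 0)‖ ≤ lam * ‖ξ' z (u, 0)‖)
    (h4 : ∀ z ∈ D, ∀ (u : EuclideanSpace ℝ (Fin n)) (v : Y),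
      ‖η' z (0, v)‖ * ‖u‖ ≤ (1 - τ) * ‖ξ' z (u, 0)‖ * ‖v‖)
    (hcone : 2 * Real.sqrt (ν * lam) < τ)
    (hμbig : (τ + 2 * lam) / (τ - 2 * lam * ν) < μ)
    (h0D : (0 : EuclideanSpace ℝ (Fin n) × Y) ∈ D)
    (hfix : ξ 0 = 0 ∧ η 0 = 0) :
    ∃ (ρ : ℝ) (γstar : EuclideanSpace ℝ (Fin n) → Y), 0 < ρ ∧
      γstar 0 = 0 ∧
      (∀ x ∈ Metric.closedBall (0 : EuclideanSpace ℝ (Fin n)) ρ,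
        ∀ y ∈ Metric.closedBall (0 : EuclideanSpace ℝ (Fin n)) ρ,
          ‖γstar x - γstar y‖ ≤ (2 * lam / τ) * ‖x - y‖) ∧
      (∀ x ∈ Metric.closedBall (0 : EuclideanSpace ℝ (Fin n)) ρ, (x, γstar x) ∈ D) ∧
      ((fun z => (ξ z, η z)) ''
          {p : EuclideanSpace ℝ (Fin n) × Y |
            p.1 ∈ Metric.closedBall (0 : EuclideanSpace ℝ (Fin n)) ρ ∧
            p.2 = γstar p.1} ∩
        (Metric.closedBall (0 : EuclideanSpace ℝ (Fin n)) ρ ×ˢ (univ : Set Y)) =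
          {p : EuclideanSpace ℝ (Fin n) × Y |
            p.1 ∈ Metric.closedBall (0 : EuclideanSpace ℝ (Fin n)) ρ ∧
            p.2 = γstar p.1}) ∧
      (∀ (θ : ℝ) (γ : EuclideanSpace ℝ (Fin n) → Y),
        θ < min (τ / ν - 2 * lam / τ) (min ((μ - 1) / (μ * ν + 1)) (τ / (2 * ν))) →
        γ 0 = 0 →
        (∀ x ∈ Metric.closedBall (0 : EuclideanSpace ℝ (Fin n)) ρ,
          ∀ y ∈ Metric.closedBall (0 : EuclideanSpace ℝ (Fin n)) ρ,
            ‖γ x - γ y‖ ≤ θ * ‖x - y‖) →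
        {p : EuclideanSpace ℝ (Fin n) × Y |
            p.1 ∈ Metric.closedBall (0 : EuclideanSpace ℝ (Fin n)) ρ ∧
            p.2 = γ p.1} ⊆
          (fun z => (ξ z, η z)) ''
            {p : EuclideanSpace ℝ (Fin n) × Y |
              p.1 ∈ Metric.closedBall (0 : EuclideanSpace ℝ (Fin n)) ρ ∧
              p.2 = γ p.1} →
        ∀ x ∈ Metric.closedBall (0 : EuclideanSpace ℝ (Fin n)) ρ, γ x = γstar x) := by
  classical
  obtain ⟨hlt, ε, hε, hε1, hE1, hE2, hE3, hE4⟩ :=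
    lum_eps μ ν lam τ hμ hν hlam hτ0 hτ1 hcone hμbig
  obtain ⟨hξ0, hη0⟩ := hfix
  rcases Nat.eq_zero_or_pos n with hn | hn
  · subst hn
    have hall : ∀ x : EuclideanSpace ℝ (Fin 0), x = 0 := fun x => Subsingleton.elim _ _
    refine ⟨1, fun _ => 0, one_pos, rfl, ?_, ?_, ?_, ?_⟩
    · intro x _ y _
      rw [hall x, hall y]; simp
    · intro x _
      rw [hall x]; exact h0D
    · ext ⟨x, y⟩
      have h00 : ((0 : EuclideanSpace ℝ (Fin 0)), (0 : Y)) = 0 := rfl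
      constructor
      · rintro ⟨⟨⟨a, b⟩, ⟨_, hb⟩, hab⟩, hx⟩
        refine ⟨hx.1, ?_⟩
        simp only at hb
        rw [hall a, hb, h00] at hab
        simp only [hη0, Prod.mk.injEq] at hab
        exact hab.2.symm
      · rintro ⟨hx, hy⟩
        simp only at hy
        refine ⟨⟨0, ⟨by simp, rfl⟩, ?_⟩, hx, mem_univ _⟩
        simp only [hη0, Prod.mk.injEq]
        exact ⟨Subsingleton.elim _ _, hy.symm⟩
    · intro θ γ _ hγ _ _ x _
      rw [hall x]; exact hγ
  haveI : Nonempty (Fin n) := ⟨⟨0, hn⟩⟩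
  have ht3 : 0 < τ / (2 * ν) := by positivity
  set t0 := 2 * lam / τ with ht0
  set t3 := τ / (2 * ν) with ht3d
  have ht0' : 0 ≤ t0 := by positivity
  -- the linear part
  let A0 : EuclideanSpace ℝ (Fin n) →L[ℝ] EuclideanSpace ℝ (Fin n) :=
    (ξ' 0).comp (ContinuousLinearMap.inl ℝ _ _)
  have hA0 : ∀ u, A0 u = ξ' 0 (u, 0) := fun u => rfl
  obtain ⟨u0, hu0, hmin⟩ := (isCompact_sphere (0 : EuclideanSpace ℝ (Fin n)) 1).exists_isMinOn
    (NormedSpace.sphere_nonempty.2 zero_le_one) (f := fun u => ‖A0 u‖)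
    (A0.continuous.norm.continuousOn)
  have hu0' : ‖u0‖ = 1 := by simpa using hu0
  set m := ‖A0 u0‖ with hm
  have hμm : μ ≤ m := by
    have := h1 0 h0D u0
    rw [hu0', mul_one] at this; exact this
  have hm0 : 0 < m := hμ.trans_le hμm
  have hAm : ∀ u, m * ‖u‖ ≤ ‖A0 u‖ := by
    intro u
    by_cases hu : u = 0
    · simp [hu]
    have hu' : 0 < ‖u‖ := norm_pos_iff.2 hu
    have h := hmin (show ‖u‖⁻¹ • u ∈ Metric.sphere (0 : EuclideanSpace ℝ (Fin n)) 1 by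
      rw [mem_sphere_zero_iff_norm, norm_smul, norm_inv, norm_norm, inv_mul_cancel₀ hu'.ne'])
    simp only [mem_ofPred_eq, map_smul, norm_smul, norm_inv, norm_norm] at h
    rw [inv_mul_eq_div, le_div_iff₀ hu'] at h
    exact h
  have hAinj : Function.Injective A0 := by
    rw [injective_iff_map_eq_zero]
    intro u hu
    have := hAm u
    rw [hu, norm_zero] at this
    exact norm_le_zero_iff.1 (by nlinarith [norm_nonneg u])
  let A : EuclideanSpace ℝ (Fin n) ≃L[ℝ] EuclideanSpace ℝ (Fin n) :=
    (LinearEquiv.ofInjectiveEndo (A0 : _ →ₗ[ℝ] _) hAinj).toContinuousLinearEquiv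
  have hAA : ∀ u, A u = ξ' 0 (u, 0) := fun u => rfl
  have hB : ∀ v, ‖ξ' 0 (0, v)‖ ≤ ν * m * ‖v‖ := by
    intro v
    have := h2 0 h0D u0 v
    rwa [hu0', mul_one] at this
  have hC : ∀ v, ‖η' 0 (0, v)‖ ≤ (1 - τ) * m * ‖v‖ := by
    intro v
    have := h4 0 h0D u0 v
    rwa [hu0', mul_one] at this
  -- the neighbourhood
  have hεm : 0 < ε * m := mul_pos hε hm0
  have n1 : ∀ᶠ z in nhds (0 : EuclideanSpace ℝ (Fin n) × Y), ‖ξ' z - ξ' 0‖ < ε * m := by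
    have := (hξc.continuousAt (hD.mem_nhds h0D)).eventually (Metric.ball_mem_nhds _ hεm)
    simpa only [dist_eq_norm] using this
  have n2 : ∀ᶠ z in nhds (0 : EuclideanSpace ℝ (Fin n) × Y), ‖η' z - η' 0‖ < ε * m := by
    have := (hηc.continuousAt (hD.mem_nhds h0D)).eventually (Metric.ball_mem_nhds _ hεm)
    simpa only [dist_eq_norm] using this
  obtain ⟨r, hr, hball⟩ := Metric.eventually_nhds_iff.1 ((hD.eventually_mem h0D).and (n1.and n2))
  obtain ⟨ρ, hρ, hρ1, hρ2⟩ : ∃ ρ : ℝ, 0 < ρ ∧ ρ < r ∧ t3 * ρ < r := by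
    refine ⟨r / (2 + t3), by positivity, ?_, ?_⟩
    · rw [div_lt_iff₀ (by positivity)]; nlinarith
    · rw [← mul_div_assoc, div_lt_iff₀ (by positivity)]; nlinarith
  let K : Set (EuclideanSpace ℝ (Fin n) × Y) :=
    Metric.closedBall 0 ρ ×ˢ Metric.closedBall 0 (t3 * ρ)
  have hKc : Convex ℝ K := (convex_closedBall _ _).prod (convex_closedBall _ _)
  have hK : ∀ z ∈ K, z ∈ D ∧ ‖ξ' z - ξ' 0‖ < ε * m ∧ ‖η' z - η' 0‖ < ε * m := by
    intro z hz
    apply hball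
    rw [dist_zero_right, Prod.norm_def]
    have z1 := hz.1
    have z2 := hz.2
    rw [mem_closedBall_zero_iff] at z1 z2
    exact max_lt (z1.trans_lt hρ1) (z2.trans_lt hρ2)
  have hKmem : ∀ (x : EuclideanSpace ℝ (Fin n)) (y : Y), ‖x‖ ≤ ρ → ‖y‖ ≤ t3 * ρ → (x, y) ∈ K :=
    fun x y hx hy => ⟨mem_closedBall_zero_iff.2 hx, mem_closedBall_zero_iff.2 hy⟩
  have hsplit : ∀ (u : EuclideanSpace ℝ (Fin n)) (v : Y), (u, v) = (u, 0) + (0, v) := by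
    intro u v; simp
  have hestξ : ∀ x1 x2 : EuclideanSpace ℝ (Fin n), ∀ y1 y2 : Y, ‖x1‖ ≤ ρ → ‖x2‖ ≤ ρ →
      ‖y1‖ ≤ t3 * ρ → ‖y2‖ ≤ t3 * ρ →
      ‖ξ (x1, y1) - ξ (x2, y2) - A (x1 - x2)‖ ≤
        (1 - (1 - ε)) * m * ‖x1 - x2‖ + (ν + ε) * m * ‖y1 - y2‖ := by
    intro x1 x2 y1 y2 hx1 hx2 hy1 hy2
    have h := lum_mvt (fun z => ξ z - ξ' 0 z) (fun z => ξ' z - ξ' 0) K hKc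
      (fun z hz => (hξ z (hK z hz).1).sub (ξ' 0).hasFDerivAt) (x1, y1) (x2, y2)
      (hKmem _ _ hx1 hy1) (hKmem _ _ hx2 hy2) (ε * m * (‖x1 - x2‖ + ‖y1 - y2‖)) (by
        intro z hz
        refine ((ξ' z - ξ' 0).le_opNorm _).trans ?_
        have : ‖((x1, y1) : EuclideanSpace ℝ (Fin n) × Y) - (x2, y2)‖ ≤
            ‖x1 - x2‖ + ‖y1 - y2‖ := by
          rw [Prod.norm_def]
          exact max_le_add_of_nonneg (norm_nonneg _) (norm_nonneg _)
        exact mul_le_mul (hK z hz).2.1.le this (norm_nonneg _) hεm.le)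
    have e : ξ (x1, y1) - ξ (x2, y2) - A (x1 - x2) =
        ((ξ (x1, y1) - ξ' 0 (x1, y1)) - (ξ (x2, y2) - ξ' 0 (x2, y2))) + ξ' 0 (0, y1 - y2) := by
      have e1 : ξ' 0 (x1, y1) - ξ' 0 (x2, y2) = ξ' 0 (x1 - x2, 0) + ξ' 0 (0, y1 - y2) := by
        rw [← map_sub, ← map_add]; simp
      rw [hAA, eq_sub_of_add_eq e1.symm]
      abel
    rw [e]
    refine (norm_add_le _ _).trans ?_
    have := hB (y1 - y2)
    linarith
  have hestη : ∀ x1 x2 : EuclideanSpace ℝ (Fin n), ∀ y1 y2 : Y, ‖x1‖ ≤ ρ → ‖x2‖ ≤ ρ →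
      ‖y1‖ ≤ t3 * ρ → ‖y2‖ ≤ t3 * ρ →
      ‖η (x1, y1) - η (x2, y2)‖ ≤
        lam * (1 + ε) * ‖A (x1 - x2)‖ + (1 - τ + ε) * (m * ‖y1 - y2‖) := by
    intro x1 x2 y1 y2 hx1 hx2 hy1 hy2
    refine lum_mvt η η' K hKc (fun z hz => hη z (hK z hz).1) _ _
      (hKmem _ _ hx1 hy1) (hKmem _ _ hx2 hy2) _ ?_
    intro z hz
    obtain ⟨hzD, hz1, hz2⟩ := hK z hz
    rw [Prod.mk_sub_mk, hsplit, map_add]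
    refine (norm_add_le _ _).trans (add_le_add ?_ ?_)
    · refine (h3 z hzD _).trans ?_
      rw [mul_assoc]
      refine mul_le_mul_of_nonneg_left ?_ hlam
      have e : ξ' z (x1 - x2, 0) = ξ' 0 (x1 - x2, 0) + (ξ' z - ξ' 0) (x1 - x2, 0) := by simp
      rw [e]
      refine (norm_add_le _ _).trans ?_
      have b1 := (ξ' z - ξ' 0).le_opNorm (x1 - x2, 0)
      have b2 : ‖((x1 - x2, 0) : EuclideanSpace ℝ (Fin n) × Y)‖ = ‖x1 - x2‖ := by
        simp [Prod.norm_def]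
      rw [b2] at b1
      have b3 := mul_le_mul_of_nonneg_right hz1.le (norm_nonneg (x1 - x2))
      have b4 := mul_le_mul_of_nonneg_left (hAm (x1 - x2)) hε.le
      rw [hA0] at b4
      rw [hAA]
      linarith
    · have e : η' z (0, y1 - y2) = η' 0 (0, y1 - y2) + (η' z - η' 0) (0, y1 - y2) := by simp
      rw [e]
      refine (norm_add_le _ _).trans ?_
      have b1 := (η' z - η' 0).le_opNorm (0, y1 - y2)
      have b2 : ‖((0, y1 - y2) : EuclideanSpace ℝ (Fin n) × Y)‖ = ‖y1 - y2‖ := by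
        simp [Prod.norm_def]
      rw [b2] at b1
      have b3 := mul_le_mul_of_nonneg_right hz2.le (norm_nonneg (y1 - y2))
      have b4 := hC (y1 - y2)
      linarith
  have hE0 : 0 < (1 - ε) - (ν + ε) * t0 := by
    by_contra hcon
    push Not at hcon
    nlinarith
  obtain ⟨γ, g0, glip, ginv, gfix, guniq⟩ := lum_core ξ η A m (1 - ε) (ν + ε) (lam * (1 + ε))
    (1 - τ + ε) t0 t3 ρ hm0 hρ (by linarith) (by linarith) (by positivity) (by linarith) ht0'
    hlt.le hE1 hE2 hE3 (hE4.trans (by gcongr)) hAm hξ0 hη0 hestξ hestη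
  refine ⟨ρ, γ, hρ, g0, ?_, ?_, ?_, ?_⟩
  · intro x hx y hy
    exact glip x y (mem_closedBall_zero_iff.1 hx) (mem_closedBall_zero_iff.1 hy)
  · intro x hx
    rw [mem_closedBall_zero_iff] at hx
    refine (hK _ (hKmem x (γ x) hx ?_)).1
    have := glip x 0 hx (by simpa using hρ.le)
    rw [g0, sub_zero, sub_zero] at this
    exact this.trans (mul_le_mul hlt.le hx (norm_nonneg _) ht3.le)
  · ext ⟨x, y⟩
    constructor
    · rintro ⟨⟨⟨a, b⟩, ⟨ha, hb⟩, hab⟩, hx⟩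
      simp only at ha hb
      subst hb
      simp only [Prod.mk.injEq] at hab
      obtain ⟨hab1, hab2⟩ := hab
      subst hab1 hab2
      refine ⟨hx.1, ?_⟩
      exact gfix a (mem_closedBall_zero_iff.1 ha) (mem_closedBall_zero_iff.1 hx.1)
    · rintro ⟨hx, hy⟩
      simp only at hx hy
      obtain ⟨u, hu, hu1, hu2⟩ := ginv x (mem_closedBall_zero_iff.1 hx)
      refine ⟨⟨(u, γ u), ⟨mem_closedBall_zero_iff.2 hu, rfl⟩, ?_⟩, hx, mem_univ _⟩
      simp only [hu1, hu2, hy]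
  · intro θ g hθ hg0 hgl hsub x hx
    have hθ3 : θ ≤ t3 := (hθ.trans_le ((min_le_right _ _).trans (min_le_right _ _))).le
    refine guniq g ?_ ?_ x (mem_closedBall_zero_iff.1 hx)
    · intro x hx
      have := hgl x (mem_closedBall_zero_iff.2 hx) 0 (by simpa using hρ.le)
      rw [hg0, sub_zero, sub_zero] at this
      exact this.trans (by gcongr)
    · intro x hx
      obtain ⟨⟨a, b⟩, ⟨ha, hb⟩, hab⟩ := hsub (show (x, g x) ∈ _ from
        ⟨mem_closedBall_zero_iff.2 hx, rfl⟩)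
      simp only at ha hb
      subst hb
      simp only [Prod.mk.injEq] at hab
      exact ⟨a, mem_closedBall_zero_iff.1 ha, hab.1, hab.2⟩
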